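/- arXiv:1304.5643 — 2 statements merged into one kernel-verified Lean document; each statement's English description precedes it below -/
import Mathlib

section
/- Minimal satisfying function: let (I, δ) be a timely specification with δ satisfiable. Then the function t* : I → 𝕋 defined by t*(i) = −inf_{j ∈ I} δ̂(i,j) is well defined (takes values in 𝕋), satisfies δ, and is minimal in every coordinate: every t ∈ T(δ) satisfies t(i) ≥ t*(i) for all i ∈ I. -/
noncomputable section

/-- `D ≤ ℝ` (an additive subgroup) is closed under infima of nonempty
bounded-below subsets. -/
def ClosedUnderInf (D : AddSubgroup ℝ) : Prop :=
  ∀ S : Set ℝ, S.Nonempty → BddBelow S → S ⊆ (D : Set ℝ) → sInf S ∈ D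

/-- A timely constraint on `I`: on every pair of distinct actions, `δ` takes a value
in `Δ = D ∪ {-∞, +∞}`, viewed inside the extended reals. -/
def IsTimelyConstraint (D : AddSubgroup ℝ) {I : Type*} (δ : I → I → EReal) : Prop :=
  ∀ i j : I, i ≠ j → δ i j = ⊤ ∨ δ i j = ⊥ ∨ ∃ d : ℝ, d ∈ D ∧ δ i j = (d : EReal)

/-- `t : I → ℝ` takes values in `𝕋` (the nonnegative part of `D`) and satisfies the
timely constraint `δ`, i.e. `t j ≤ t i + δ i j` for all distinct `i, j`. -/
def Satisfies (D : AddSubgroup ℝ) {I : Type*} (δ : I → I → EReal) (t : I → ℝ) : Prop :=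
  (∀ i, t i ∈ D) ∧ (∀ i, 0 ≤ t i) ∧
    ∀ i j : I, i ≠ j → (t j : EReal) ≤ (t i : EReal) + δ i j

/-- A path in the graph `G_δ`: a nonempty finite sequence of vertices, each consecutive
pair being an edge, i.e. a pair of distinct vertices with `δ < ∞`. -/
def IsPath {I : Type*} (δ : I → I → EReal) (p : List I) : Prop :=
  p ≠ [] ∧ p.Chain' fun a b => a ≠ b ∧ δ a b < ⊤

/-- The length of a path: the sum of the weights of its edges. -/
def pathLength {I : Type*} (δ : I → I → EReal) (p : List I) : EReal :=
  ((p.zip p.tail).map fun q => δ q.1 q.2).sum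

/-- The canonical form `δ̂` of `δ`: the distance function of `G_δ`, i.e. the infimum in
the extended reals of the lengths of all paths from `i` to `j` (`+∞` if there is none). -/
def canon {I : Type*} (δ : I → I → EReal) (i j : I) : EReal :=
  sInf {L : EReal | ∃ p : List I,
    IsPath δ p ∧ p.head? = some i ∧ p.getLast? = some j ∧ pathLength δ p = L}

/-- A negative cycle in `G_δ`: a path with at least two entries, whose first and last
vertices coincide, of negative length. -/
def IsNegativeCycle {I : Type*} (δ : I → I → EReal) (p : List I) : Prop :=
  IsPath δ p ∧ 2 ≤ p.length ∧ p.head? = p.getLast? ∧ pathLength δ p < 0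

section Paths

variable {I : Type*} {δ : I → I → EReal}

lemma isPath_singleton (i : I) : IsPath δ [i] :=
  ⟨by simp, List.isChain_singleton i⟩

lemma isPath_cons_cons {a b : I} {l : List I} :
    IsPath δ (a :: b :: l) ↔ (a ≠ b ∧ δ a b < ⊤) ∧ IsPath δ (b :: l) := by
  simp only [IsPath, ne_eq, reduceCtorEq, not_false_eq_true, true_and]
  exact List.isChain_cons_cons

lemma pathLength_singleton (i : I) : pathLength δ [i] = 0 := by
  simp [pathLength]

lemma pathLength_cons_cons (a b : I) (l : List I) :
    pathLength δ (a :: b :: l) = δ a b + pathLength δ (b :: l) := by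
  simp [pathLength]

/-- The finite lengths of the paths starting at `i`. -/
def pathLengths (δ : I → I → EReal) (i : I) : Set ℝ :=
  {x | ∃ l : List I, IsPath δ (i :: l) ∧ pathLength δ (i :: l) = (x : EReal)}

lemma zero_mem_pathLengths (i : I) : (0 : ℝ) ∈ pathLengths δ i :=
  ⟨[], isPath_singleton i, by simp [pathLength_singleton]⟩

lemma add_mem_pathLengths {i j : I} (hij : i ≠ j) {d x : ℝ} (hd : δ i j = d)
    (hx : x ∈ pathLengths δ j) : d + x ∈ pathLengths δ i := by
  obtain ⟨l, hl, hlx⟩ := hx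
  refine ⟨j :: l, isPath_cons_cons.2 ⟨⟨hij, hd ▸ EReal.coe_lt_top d⟩, hl⟩, ?_⟩
  rw [pathLength_cons_cons, hd, hlx, EReal.coe_add]

variable {D : AddSubgroup ℝ} {t : I → ℝ}

lemma Satisfies.ne_bot (ht : Satisfies D δ t) {i j : I} (hij : i ≠ j) : δ i j ≠ ⊥ := by
  intro h
  simpa [h] using ht.2.2 i j hij

lemma Satisfies.le_add (ht : Satisfies D δ t) {i j : I} (hij : i ≠ j) {d : ℝ}
    (hd : δ i j = d) : t j ≤ t i + d := by
  have h := ht.2.2 i j hij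
  rw [hd] at h
  exact_mod_cast h

/-- In a satisfiable specification, every path has a finite length in `D`, which is at least
minus the value of any satisfying function at the start of the path. -/
lemma exists_pathLength_eq_coe (hδ : IsTimelyConstraint D δ) (hsat : ∃ t, Satisfies D δ t)
    (i : I) (l : List I) (hl : IsPath δ (i :: l)) :
    ∃ x ∈ D, pathLength δ (i :: l) = (x : EReal) ∧ ∀ t, Satisfies D δ t → -t i ≤ x := by
  induction l generalizing i with
  | nil =>
    exact ⟨0, D.zero_mem, by simp [pathLength_singleton], fun t ht => by linarith [ht.2.1 i]⟩
  | cons b l ih =>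
    obtain ⟨⟨hib, htop⟩, hb⟩ := isPath_cons_cons.1 hl
    obtain ⟨x, hxD, hx, hxt⟩ := ih b hb
    obtain ⟨s, hs⟩ := hsat
    obtain h | h | ⟨d, hdD, hd⟩ := hδ i b hib
    · exact absurd h htop.ne
    · exact absurd h (hs.ne_bot hib)
    · refine ⟨d + x, D.add_mem hdD hxD, ?_, fun t ht => ?_⟩
      · rw [pathLength_cons_cons, hd, hx, EReal.coe_add]
      · linarith [hxt t ht, ht.le_add hib hd]

lemma pathLengths_subset (hδ : IsTimelyConstraint D δ) (hsat : ∃ t, Satisfies D δ t) (i : I) :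
    pathLengths δ i ⊆ (D : Set ℝ) := by
  rintro x ⟨l, hl, hx⟩
  obtain ⟨y, hyD, hy, -⟩ := exists_pathLength_eq_coe hδ hsat i l hl
  rwa [EReal.coe_eq_coe_iff.1 (hx.symm.trans hy)]

lemma Satisfies.neg_mem_lowerBounds (hδ : IsTimelyConstraint D δ) (ht : Satisfies D δ t)
    (i : I) : -t i ∈ lowerBounds (pathLengths δ i) := by
  rintro x ⟨l, hl, hx⟩
  obtain ⟨y, -, hy, hyt⟩ := exists_pathLength_eq_coe hδ ⟨t, ht⟩ i l hl
  rw [EReal.coe_eq_coe_iff.1 (hx.symm.trans hy)]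
  exact hyt t ht

lemma bddBelow_pathLengths (hδ : IsTimelyConstraint D δ) (hsat : ∃ t, Satisfies D δ t) (i : I) :
    BddBelow (pathLengths δ i) :=
  let ⟨_, ht⟩ := hsat
  ⟨_, ht.neg_mem_lowerBounds hδ i⟩

lemma iInf_canon_le {i : I} {x : ℝ} (hx : x ∈ pathLengths δ i) :
    ⨅ j, canon δ i j ≤ (x : EReal) := by
  obtain ⟨l, hl, hlx⟩ := hx
  exact (iInf_le _ ((i :: l).getLast (by simp))).trans
    (sInf_le ⟨i :: l, hl, rfl, List.getLast?_eq_some_getLast _, hlx⟩)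

lemma iInf_canon_eq (hδ : IsTimelyConstraint D δ) (hsat : ∃ t, Satisfies D δ t) (i : I) :
    ⨅ j, canon δ i j = (sInf (pathLengths δ i) : ℝ) := by
  have hge : ((sInf (pathLengths δ i) : ℝ) : EReal) ≤ ⨅ j, canon δ i j := by
    refine le_iInf fun j => le_sInf ?_
    rintro L ⟨p, hp, hhead, -, rfl⟩
    obtain ⟨l, rfl⟩ := List.head?_eq_some_iff.1 hhead
    obtain ⟨x, -, hx, -⟩ := exists_pathLength_eq_coe hδ hsat i l hp
    rw [hx, EReal.coe_le_coe_iff]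
    exact csInf_le (bddBelow_pathLengths hδ hsat i) ⟨l, hp, hx⟩
  refine le_antisymm ?_ hge
  have hbot : ⨅ j, canon δ i j ≠ ⊥ := ((EReal.bot_lt_coe _).trans_le hge).ne'
  have htop : ⨅ j, canon δ i j ≠ ⊤ :=
    ((iInf_canon_le (zero_mem_pathLengths i)).trans_lt (EReal.coe_lt_top 0)).ne
  rw [← EReal.coe_toReal htop hbot, EReal.coe_le_coe_iff]
  refine le_csInf ⟨0, zero_mem_pathLengths i⟩ fun x hx => ?_
  rw [← EReal.coe_le_coe_iff, EReal.coe_toReal htop hbot]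
  exact iInf_canon_le hx

end Paths

/-- Minimal satisfying function: if `δ` is satisfiable, then
`t* : i ↦ -inf_{j} δ̂(i,j)` takes values in `𝕋`, satisfies `δ`, and is minimal in
every coordinate among all satisfying functions. -/
theorem minimal_satisfying_function (D : AddSubgroup ℝ) (hD : ClosedUnderInf D)
    {I : Type*} (δ : I → I → EReal) (hδ : IsTimelyConstraint D δ)
    (hsat : ∃ t : I → ℝ, Satisfies D δ t) :
    Satisfies D δ (fun i => (-(⨅ j : I, canon δ i j)).toReal) ∧
      ∀ t : I → ℝ, Satisfies D δ t →
        ∀ i : I, (-(⨅ j : I, canon δ i j)).toReal ≤ t i := by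
  have hval : ∀ i : I, (-(⨅ j : I, canon δ i j)).toReal = -sInf (pathLengths δ i) := fun i => by
    rw [iInf_canon_eq hδ hsat i, ← EReal.coe_neg, EReal.toReal_coe]
  have hne : ∀ i : I, (pathLengths δ i).Nonempty := fun i => ⟨0, zero_mem_pathLengths i⟩
  have hbdd := bddBelow_pathLengths hδ hsat
  simp only [hval]
  refine ⟨⟨fun i => D.neg_mem (hD _ (hne i) (hbdd i) (pathLengths_subset hδ hsat i)),
    fun i => neg_nonneg.2 (csInf_le (hbdd i) (zero_mem_pathLengths i)), fun i j hij => ?_⟩,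
    fun t ht i => neg_le.1 (le_csInf (hne i) (ht.neg_mem_lowerBounds hδ i))⟩
  obtain h | h | ⟨d, -, hd⟩ := hδ i j hij
  · simp [h]
  · obtain ⟨t, ht⟩ := hsat
    exact absurd h (ht.ne_bot hij)
  · have key : sInf (pathLengths δ i) - d ≤ sInf (pathLengths δ j) :=
      le_csInf (hne j) fun x hx => by
        linarith [csInf_le (hbdd i) (add_mem_pathLengths hij hd hx)]
    rw [hd, ← EReal.coe_add, EReal.coe_le_coe_iff]
    linarith
end
end

section
/- Lower bound for satisfying functions: let (I, δ) be a timely specification with δ satisfiable. Then for every t ∈ T(δ) and every i ∈ I, one has t(i) ≥ −inf_{j ∈ I} δ̂(i,j). -/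
noncomputable section

/-- A satisfying function grows along a path by at most the length of the path. -/
theorem Satisfies.le_add_pathLength {D : AddSubgroup ℝ} {I : Type*} {δ : I → I → EReal}
    {t : I → ℝ} (ht : Satisfies D δ t) {p : List I} (hp : IsPath δ p) {i j : I}
    (hi : p.head? = some i) (hj : p.getLast? = some j) :
    (t j : EReal) ≤ (t i : EReal) + pathLength δ p := by
  induction p generalizing i with
  | nil => simp at hi
  | cons a l ih =>
    obtain rfl : a = i := by simpa using hi
    cases l with
    | nil =>
      obtain rfl : a = j := by simpa using hj
      simp [pathLength]
    | cons b l =>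
      obtain ⟨hab, hl⟩ := List.isChain_cons_cons.mp hp.2
      have hlen : pathLength δ (a :: b :: l) = δ a b + pathLength δ (b :: l) := by
        simp [pathLength]
      calc (t j : EReal) ≤ t b + pathLength δ (b :: l) :=
            ih ⟨by simp, hl⟩ rfl (by simpa using hj)
        _ ≤ t a + δ a b + pathLength δ (b :: l) := by
            gcongr
            exact ht.2.2 a b hab.1
        _ = t a + pathLength δ (a :: b :: l) := by rw [hlen, add_assoc]

/-- Lower bound for satisfying functions: for every `t ∈ T(δ)` and every
`i`, one has `t(i) ≥ -inf_{j} δ̂(i,j)`. -/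
theorem satisfying_function_lower_bound (D : AddSubgroup ℝ) (hD : ClosedUnderInf D)
    {I : Type*} (δ : I → I → EReal) (hδ : IsTimelyConstraint D δ)
    (hsat : ∃ t : I → ℝ, Satisfies D δ t)
    (t : I → ℝ) (ht : Satisfies D δ t) (i : I) :
    -(⨅ j : I, canon δ i j) ≤ ((t i : ℝ) : EReal) := by
  rw [EReal.neg_le]
  refine le_iInf fun j => le_sInf ?_
  rintro L ⟨p, hp, hi, hj, rfl⟩
  have h : (0 : EReal) ≤ t i + pathLength δ p :=
    (EReal.coe_nonneg.mpr (ht.2.1 j)).trans (ht.le_add_pathLength hp hi hj)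
  rw [add_comm] at h
  simpa using EReal.sub_le_of_le_add h
end
end
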